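/- Let n ∈ ℕ and let a_i > 0, b_i > 0 and γ_i > 0 for 1 ≤ i ≤ n. Then the family ((a_1 + k_1^{γ_1} b_1,…,a_n + k_n^{γ_n} b_n)) indexed by (k_1,…,k_n) ∈ ℕ^n is a uniqueness sequence for the n-dimensional Laplace transform if and only if γ_i ≤ 1 for all i = 1,…,n. -/

import Mathlib

open MeasureTheory Filter Set

noncomputable section

/-- Partial Laplace integral of `f : [0,∞) → ℂ` at `l` up to time `t`. -/
def lapPartial (f : ℝ → ℂ) (l : ℂ) (t : ℝ) : ℂ :=
  ∫ s in Set.Ioc (0:ℝ) t, Complex.exp (-(l * s)) * f s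

/-- The Laplace transform of `f` at `l` exists and equals `F`. -/
def HasLaplace (f : ℝ → ℂ) (l : ℂ) (F : ℂ) : Prop :=
  Filter.Tendsto (lapPartial f l) Filter.atTop (nhds F)

/-- The abscissa of convergence of the Laplace transform of `f`, as an extended real. -/
def laplaceAbs (f : ℝ → ℂ) : EReal :=
  sInf {x : EReal | ∃ ω : ℝ, x = (ω : EReal) ∧ ∀ l : ℂ, ω < l.re → ∃ F, HasLaplace f l F}

/-- `lam` is a uniqueness sequence for the one-dimensional Laplace transform. -/
def IsUniquenessSeq (lam : ℕ → ℂ) : Prop :=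
  ∀ f : ℝ → ℂ, MeasureTheory.LocallyIntegrableOn f (Set.Ici 0) →
    (∀ k, laplaceAbs f < (((lam k).re : ℝ) : EReal)) →
    (∀ k, HasLaplace f (lam k) 0) →
    ∀ᵐ t : ℝ, 0 ≤ t → f t = 0

/-- Partial `n`-dimensional Laplace integral of `f : [0,∞)^n → ℂ` at `l` over the box `[0,t]`. -/
def mLapPartial (n : ℕ) (f : (Fin n → ℝ) → ℂ) (l : Fin n → ℂ) (t : Fin n → ℝ) : ℂ :=
  ∫ s in Set.pi Set.univ (fun i => Set.Ioc (0:ℝ) (t i)),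
    Complex.exp (-(∑ i, l i * (s i))) * f s

/-- The `n`-dimensional Laplace transform of `f` at `l` exists (as the iterated limit
`t₁ → ∞, …, tₙ → ∞` of the partial integrals) and equals `F`. -/
def HasMLaplace (n : ℕ) (f : (Fin n → ℝ) → ℂ) (l : Fin n → ℂ) (F : ℂ) : Prop :=
  Filter.Tendsto (mLapPartial n f l) Filter.atTop (nhds F)

/-- `Ω(f)`: the region of convergence of the `n`-dimensional Laplace integral. -/
def mOmega (n : ℕ) (f : (Fin n → ℝ) → ℂ) : Set (Fin n → ℂ) :=
  {l | ∃ F, HasMLaplace n f l F}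

/-- `Ω_b(f)`: the set of `l` for which the partial Laplace integrals are bounded. -/
def mOmegaB (n : ℕ) (f : (Fin n → ℝ) → ℂ) : Set (Fin n → ℂ) :=
  {l | Bornology.IsBounded (mLapPartial n f l '' {t | ∀ i, 0 ≤ t i})}

/-- A countable family `lam : K → ℂⁿ` is a uniqueness sequence for the `n`-dimensional
Laplace transform. -/
def IsMUniquenessFamily (n : ℕ) {K : Type} [Countable K] (lam : K → Fin n → ℂ) : Prop :=
  ∀ f : (Fin n → ℝ) → ℂ,
    MeasureTheory.LocallyIntegrableOn f {t | ∀ i, 0 ≤ t i} →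
    (∃ ω : Fin n → EReal, (∀ j, ω j ≠ ⊤) ∧
      {l : Fin n → ℂ | ∀ j, ω j < (((l j).re : ℝ) : EReal)} ⊆ mOmegaB n f ∩ mOmega n f ∧
      ∀ k j, ω j < ((((lam k j).re : ℝ)) : EReal)) →
    (∀ k, HasMLaplace n f (lam k) 0) →
    ∀ᵐ t : Fin n → ℝ, (∀ i, 0 ≤ t i) → f t = 0


/-- Successive applications of the operators `F ↦ F (· - τ k) - ε k * F` to the ramp `t ↦ t⁺`. -/
def shiftSeq (τ ε : ℕ → ℝ) : ℕ → ℝ → ℝ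
  | 0 => fun t => max t 0
  | n + 1 => fun t => shiftSeq τ ε n (t - τ n) - ε n * shiftSeq τ ε n t

section shiftSeq

variable {τ ε : ℕ → ℝ}

lemma abs_shiftSeq_le (hτ : ∀ k, 0 ≤ τ k) (hε : ∀ k, 0 ≤ ε k) (n : ℕ) (t : ℝ) :
    |shiftSeq τ ε n t| ≤ (∏ k ∈ Finset.range n, (1 + ε k)) * max t 0 := by
  induction n generalizing t with
  | zero => simp [shiftSeq, abs_of_nonneg (le_max_right t 0)]
  | succ n ih =>
    have hP : 0 ≤ ∏ k ∈ Finset.range n, (1 + ε k) :=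
      Finset.prod_nonneg fun k _ => by linarith [hε k]
    have hmax : max (t - τ n) 0 ≤ max t 0 := max_le_max (by linarith [hτ n]) le_rfl
    have h1 := (ih (t - τ n)).trans (mul_le_mul_of_nonneg_left hmax hP)
    have h2 := mul_le_mul_of_nonneg_left (ih t) (hε n)
    rw [Finset.prod_range_succ]
    calc |shiftSeq τ ε (n + 1) t| ≤ |shiftSeq τ ε n (t - τ n)| + |ε n * shiftSeq τ ε n t| :=
          abs_sub _ _
      _ = |shiftSeq τ ε n (t - τ n)| + ε n * |shiftSeq τ ε n t| := by
          rw [abs_mul, abs_of_nonneg (hε n)]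
      _ ≤ _ := by linarith

lemma abs_shiftSeq_sub_le (hε : ∀ k, 0 ≤ ε k) (n : ℕ) (s t : ℝ) :
    |shiftSeq τ ε n s - shiftSeq τ ε n t| ≤ (∏ k ∈ Finset.range n, (1 + ε k)) * |s - t| := by
  induction n generalizing s t with
  | zero =>
    simpa [shiftSeq] using abs_max_sub_max_le_abs s t 0
  | succ n ih =>
    have h1 := ih (s - τ n) (t - τ n)
    have h2 := mul_le_mul_of_nonneg_left (ih s t) (hε n)
    rw [sub_sub_sub_cancel_right] at h1
    rw [Finset.prod_range_succ]
    calc |shiftSeq τ ε (n + 1) s - shiftSeq τ ε (n + 1) t|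
        = |(shiftSeq τ ε n (s - τ n) - shiftSeq τ ε n (t - τ n))
            - ε n * (shiftSeq τ ε n s - shiftSeq τ ε n t)| := by
          simp only [shiftSeq]; congr 1; ring
      _ ≤ |shiftSeq τ ε n (s - τ n) - shiftSeq τ ε n (t - τ n)|
            + |ε n * (shiftSeq τ ε n s - shiftSeq τ ε n t)| := abs_sub _ _
      _ = |shiftSeq τ ε n (s - τ n) - shiftSeq τ ε n (t - τ n)|
            + ε n * |shiftSeq τ ε n s - shiftSeq τ ε n t| := by
          rw [abs_mul, abs_of_nonneg (hε n)]
      _ ≤ _ := by linarith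

lemma continuous_shiftSeq (n : ℕ) : Continuous (shiftSeq τ ε n) := by
  induction n with
  | zero => exact continuous_id.max continuous_const
  | succ n ih =>
    exact (ih.comp (continuous_id.sub continuous_const)).sub (continuous_const.mul ih)

lemma shiftSeq_sub_eq (hτ : ∀ k, 0 ≤ τ k) (n : ℕ) {s t : ℝ}
    (hs : ∑ k ∈ Finset.range n, τ k ≤ s) (ht : ∑ k ∈ Finset.range n, τ k ≤ t) :
    shiftSeq τ ε n t - shiftSeq τ ε n s = (∏ k ∈ Finset.range n, (1 - ε k)) * (t - s) := by
  induction n generalizing s t with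
  | zero => simp_all [shiftSeq]
  | succ n ih =>
    rw [Finset.sum_range_succ] at hs ht
    have h1 := ih (s := s - τ n) (t := t - τ n) (by linarith) (by linarith)
    have h2 := ih (s := s) (t := t) (by linarith [hτ n]) (by linarith [hτ n])
    rw [Finset.prod_range_succ]
    simp only [shiftSeq]
    linear_combination h1 - ε n * h2

lemma shiftSeq_of_nonpos (hτ : ∀ k, 0 ≤ τ k) (hε : ∀ k, 0 ≤ ε k) (n : ℕ) {t : ℝ} (ht : t ≤ 0) :
    shiftSeq τ ε n t = 0 := by
  simpa [max_eq_right ht] using abs_shiftSeq_le hτ hε n t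

end shiftSeq

lemma integrableOn_exp_neg_mul_id {x : ℝ} (hx : 0 < x) :
    IntegrableOn (fun t : ℝ => Real.exp (-(x * t)) * t) (Ioi 0) := by
  have := integrableOn_rpow_mul_exp_neg_mul_rpow (p := 1) (s := 1) (by norm_num) one_pos hx
  refine this.congr_fun (fun t _ => ?_) measurableSet_Ioi
  simp [mul_comm]

lemma integrableOn_exp_neg_mul_of_abs_le {x C : ℝ} (hx : 0 < x) {F : ℝ → ℝ} (hF : Continuous F)
    (hb : ∀ t, |F t| ≤ C * max t 0) :
    IntegrableOn (fun t : ℝ => Real.exp (-(x * t)) * F t) (Ioi 0) := by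
  refine ((integrableOn_exp_neg_mul_id hx).const_mul C).mono'
    (Continuous.aestronglyMeasurable (by fun_prop)) ?_
  refine (ae_restrict_iff' measurableSet_Ioi).2 (Eventually.of_forall fun t ht => ?_)
  have := hb t
  rw [max_eq_left (le_of_lt ht)] at this
  rw [norm_mul, Real.norm_eq_abs, Real.norm_eq_abs, Real.abs_exp]
  nlinarith [mul_le_mul_of_nonneg_left this (Real.exp_nonneg (-(x * t)))]

lemma integral_Ioi_exp_neg_mul_shift {F : ℝ → ℝ} (hF : ∀ t ≤ 0, F t = 0) {c : ℝ} (hc : 0 ≤ c)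
    (x : ℝ) :
    ∫ t in Ioi 0, Real.exp (-(x * t)) * F (t - c)
      = Real.exp (-(x * c)) * ∫ t in Ioi 0, Real.exp (-(x * t)) * F t := by
  rw [setIntegral_eq_integral_of_forall_compl_eq_zero,
    setIntegral_eq_integral_of_forall_compl_eq_zero,
    ← integral_const_mul,
    ← integral_sub_right_eq_self (fun t => Real.exp (-(x * c)) * (Real.exp (-(x * t)) * F t)) c]
  · congr 1 with t
    rw [← mul_assoc, ← Real.exp_add]
    congr 2
    ring
  · intro t ht
    rw [hF t (by simpa using ht), mul_zero]
  · intro t ht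
    rw [hF (t - c) (by have : t ≤ 0 := by simpa using ht
                       linarith), mul_zero]

lemma integral_exp_neg_mul_shiftSeq_succ {τ ε : ℕ → ℝ} (hτ : ∀ k, 0 ≤ τ k) (hε : ∀ k, 0 ≤ ε k)
    (n : ℕ) {x : ℝ} (hx : 0 < x) :
    ∫ t in Ioi 0, Real.exp (-(x * t)) * shiftSeq τ ε (n + 1) t
      = (Real.exp (-(x * τ n)) - ε n)
          * ∫ t in Ioi 0, Real.exp (-(x * t)) * shiftSeq τ ε n t := by
  have hi := integrableOn_exp_neg_mul_of_abs_le hx (continuous_shiftSeq n) (abs_shiftSeq_le hτ hε n)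
  have hi' : IntegrableOn (fun t => Real.exp (-(x * t)) * shiftSeq τ ε n (t - τ n)) (Ioi 0) := by
    refine integrableOn_exp_neg_mul_of_abs_le (C := ∏ k ∈ Finset.range n, (1 + ε k)) hx
      (F := fun t => shiftSeq τ ε n (t - τ n))
      ((continuous_shiftSeq n).comp (continuous_id.sub continuous_const)) fun t => ?_
    exact (abs_shiftSeq_le hτ hε n _).trans (mul_le_mul_of_nonneg_left
      (max_le_max (by linarith [hτ n]) le_rfl)
      (Finset.prod_nonneg fun k _ => by linarith [hε k]))
  rw [sub_mul, ← integral_Ioi_exp_neg_mul_shift (fun t => shiftSeq_of_nonpos hτ hε n) (hτ n),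
    ← integral_const_mul, ← integral_sub hi' (hi.const_mul _)]
  congr 1 with t
  simp only [shiftSeq]
  ring

lemma integral_exp_neg_mul_shiftSeq_eq_zero {τ ε : ℕ → ℝ} (hτ : ∀ k, 0 ≤ τ k) (hε : ∀ k, 0 ≤ ε k)
    {x : ℝ} (hx : 0 < x) {k n : ℕ} (hk : Real.exp (-(x * τ k)) = ε k) (hkn : k < n) :
    ∫ t in Ioi 0, Real.exp (-(x * t)) * shiftSeq τ ε n t = 0 := by
  induction n, hkn using Nat.le_induction with
  | base => rw [integral_exp_neg_mul_shiftSeq_succ hτ hε _ hx, hk, sub_self, zero_mul]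
  | succ n _ ih => rw [integral_exp_neg_mul_shiftSeq_succ hτ hε _ hx, ih, mul_zero]

lemma prod_one_add_inv_sq_le (n : ℕ) :
    ∏ k ∈ Finset.range n, (1 + 1 / ((k : ℝ) + 2) ^ 2) ≤ 2 * ((n : ℝ) + 1) / (n + 2) := by
  induction n with
  | zero => norm_num
  | succ n ih =>
    rw [Finset.prod_range_succ]
    refine (mul_le_mul_of_nonneg_right ih (by positivity)).trans ?_
    push_cast
    rw [one_add_div (by positivity), div_mul_div_comm,
      div_le_div_iff₀ (by positivity) (by positivity)]
    have : (0 : ℝ) ≤ n := n.cast_nonneg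
    nlinarith [pow_nonneg this 2, pow_nonneg this 3, pow_nonneg this 4]

lemma half_le_prod_one_sub_inv_sq (n : ℕ) :
    ((n : ℝ) + 2) / (2 * (n + 1)) ≤ ∏ k ∈ Finset.range n, (1 - 1 / ((k : ℝ) + 2) ^ 2) := by
  induction n with
  | zero => norm_num
  | succ n ih =>
    have h1 : (0 : ℝ) ≤ 1 - 1 / ((n : ℝ) + 2) ^ 2 := by
      rw [sub_nonneg, div_le_one (by positivity)]
      nlinarith [(n.cast_nonneg : (0 : ℝ) ≤ n)]
    rw [Finset.prod_range_succ]
    refine le_trans (le_of_eq ?_) (mul_le_mul_of_nonneg_right ih h1)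
    push_cast
    field_simp
    ring

/-- If the points `μ k` are sparse enough, some nonzero function of linear growth has a Laplace
transform vanishing at all of them. -/
theorem exists_laplace_eq_zero {μ : ℕ → ℝ} (hμ : ∀ k, 0 < μ k)
    (hs : Summable fun k : ℕ => Real.log (k + 2) / μ k) :
    ∃ g : ℝ → ℝ, Continuous g ∧ (∀ t, |g t| ≤ 2 * max t 0) ∧
      (∀ k, ∫ t in Ioi 0, Real.exp (-(μ k * t)) * g t = 0) ∧ ∃ t > 0, g t ≠ 0 := by
  set ε : ℕ → ℝ := fun k => 1 / ((k : ℝ) + 2) ^ 2 with hεdef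
  set τ : ℕ → ℝ := fun k => 2 * (Real.log (k + 2) / μ k) with hτdef
  have hε : ∀ k, 0 ≤ ε k := fun k => by positivity
  have hτ : ∀ k, 0 ≤ τ k := fun k =>
    mul_nonneg zero_le_two
      (div_nonneg (Real.log_nonneg (by linarith [(k.cast_nonneg : (0 : ℝ) ≤ k)]))
      (hμ k).le)
  have hετ : ∀ k, Real.exp (-(μ k * τ k)) = ε k := fun k => by
    have : μ k * τ k = Real.log (((k : ℝ) + 2) ^ 2) := by
      rw [Real.log_pow]
      simp only [hτdef]
      have := (hμ k).ne'
      field_simp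
      push_cast
      ring
    rw [this, Real.exp_neg, Real.exp_log (by positivity)]
    simp [hεdef]
  have hτs : Summable τ := hs.mul_left 2
  have hεs : Summable ε := by
    have := (summable_nat_add_iff 2).2 (Real.summable_one_div_nat_pow.2 (one_lt_two))
    simpa [hεdef] using this
  have hP : ∀ n, ∏ k ∈ Finset.range n, (1 + ε k) ≤ 2 := fun n =>
    (prod_one_add_inv_sq_le n).trans (by rw [div_le_iff₀ (by positivity)]; linarith)
  have hbd : ∀ n t, |shiftSeq τ ε n t| ≤ 2 * max t 0 := fun n t =>
    (abs_shiftSeq_le hτ hε n t).trans (mul_le_mul_of_nonneg_right (hP n) (le_max_right _ _))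
  have hlip : ∀ n s t, |shiftSeq τ ε n s - shiftSeq τ ε n t| ≤ 2 * |s - t| := fun n s t =>
    (abs_shiftSeq_sub_le hε n s t).trans (mul_le_mul_of_nonneg_right (hP n) (abs_nonneg _))
  have hlim : ∀ t, ∃ y, Tendsto (fun n => shiftSeq τ ε n t) atTop (nhds y) := fun t => by
    refine cauchySeq_tendsto_of_complete (cauchySeq_of_dist_le_of_summable
      (fun n => 2 * τ n + 2 * max t 0 * ε n) (fun n => ?_)
      ((hτs.mul_left 2).add (hεs.mul_left (2 * max t 0))))
    have h1 := hlip n (t - τ n) t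
    have h2 := mul_le_mul_of_nonneg_left (hbd n t) (hε n)
    rw [sub_sub_cancel_left, abs_neg, abs_of_nonneg (hτ n)] at h1
    rw [dist_comm, Real.dist_eq]
    calc |shiftSeq τ ε (n + 1) t - shiftSeq τ ε n t|
        = |(shiftSeq τ ε n (t - τ n) - shiftSeq τ ε n t) - ε n * shiftSeq τ ε n t| := by
          simp only [shiftSeq]; congr 1; ring
      _ ≤ |shiftSeq τ ε n (t - τ n) - shiftSeq τ ε n t| + |ε n * shiftSeq τ ε n t| := abs_sub _ _
      _ = |shiftSeq τ ε n (t - τ n) - shiftSeq τ ε n t| + ε n * |shiftSeq τ ε n t| := by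
          rw [abs_mul, abs_of_nonneg (hε n)]
      _ ≤ _ := by linarith
  choose g hg using hlim
  refine ⟨g, ?_, fun t => le_of_tendsto (hg t).abs (Eventually.of_forall fun n => hbd n t),
    fun k => ?_, ?_⟩
  · refine LipschitzWith.continuous (K := 2) (LipschitzWith.of_dist_le_mul fun s t => ?_)
    rw [Real.dist_eq, Real.dist_eq]
    exact le_of_tendsto ((hg s).sub (hg t)).abs (Eventually.of_forall fun n => hlip n s t)
  · have hdom : Tendsto (fun n => ∫ t in Ioi 0, Real.exp (-(μ k * t)) * shiftSeq τ ε n t) atTop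
        (nhds (∫ t in Ioi 0, Real.exp (-(μ k * t)) * g t)) := by
      refine tendsto_integral_of_dominated_convergence
        (fun t => 2 * (Real.exp (-(μ k * t)) * t)) (fun n => ?_)
        ((integrableOn_exp_neg_mul_id (hμ k)).const_mul 2) (fun n => ?_)
        (Eventually.of_forall fun t => (hg t).const_mul _)
      · exact (Continuous.mul (by fun_prop) (continuous_shiftSeq n)).aestronglyMeasurable
      · refine (ae_restrict_iff' measurableSet_Ioi).2 (Eventually.of_forall fun t ht => ?_)
        have := hbd n t
        rw [max_eq_left (le_of_lt ht)] at this
        rw [norm_mul, Real.norm_eq_abs, Real.norm_eq_abs, Real.abs_exp]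
        nlinarith [mul_le_mul_of_nonneg_left this (Real.exp_nonneg (-(μ k * t)))]
    refine tendsto_nhds_unique hdom (tendsto_const_nhds.congr' ?_)
    filter_upwards [eventually_gt_atTop k] with n hn
    exact (integral_exp_neg_mul_shiftSeq_eq_zero hτ hε (hμ k) (hετ k) hn).symm
  · have hT : ∀ n, ∑ k ∈ Finset.range n, τ k ≤ ∑' k, τ k := fun n =>
      hτs.sum_le_tsum _ fun k _ => hτ k
    have hT0 : 0 ≤ ∑' k, τ k := tsum_nonneg hτ
    have hdiff : 1 / 2 ≤ g (∑' k, τ k + 2) - g (∑' k, τ k + 1) := by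
      refine ge_of_tendsto ((hg _).sub (hg _)) (Eventually.of_forall fun n => ?_)
      rw [shiftSeq_sub_eq hτ n (by linarith [hT n]) (by linarith [hT n])]
      have := half_le_prod_one_sub_inv_sq n
      have h2 : (1 / 2 : ℝ) ≤ (n + 2) / (2 * (n + 1)) := by
        rw [div_le_div_iff₀ (by positivity) (by positivity)]; linarith
      linarith
    by_contra! hcon
    rw [hcon _ (by linarith), hcon _ (by linarith)] at hdiff
    norm_num at hdiff

lemma mLapPartial_prod {n : ℕ} (F : Fin n → ℝ → ℂ) (l : Fin n → ℂ) (t : Fin n → ℝ) :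
    mLapPartial n (fun s => ∏ j, F j (s j)) l t = ∏ j, lapPartial (F j) (l j) (t j) := by
  unfold mLapPartial lapPartial
  rw [volume_pi, Measure.restrict_pi_pi, ← integral_fintype_prod_eq_prod]
  congr 1 with s
  rw [Finset.prod_mul_distrib, ← Complex.exp_sum, Finset.sum_neg_distrib]

lemma integrableOn_cexp_neg_mul_of_abs_le {l : ℂ} {C : ℝ} (hl : 0 < l.re) {F : ℝ → ℝ}
    (hF : Continuous F) (hb : ∀ t, |F t| ≤ C * max t 0) :
    IntegrableOn (fun t : ℝ => Complex.exp (-(l * t)) * F t) (Ioi 0) := by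
  refine (integrableOn_exp_neg_mul_of_abs_le hl hF hb).norm.mono'
    (Continuous.aestronglyMeasurable (by fun_prop)) (Eventually.of_forall fun t => ?_)
  simp [Complex.norm_exp]

lemma hasLaplace_of_integrableOn {F : ℝ → ℂ} {l : ℂ}
    (h : IntegrableOn (fun t : ℝ => Complex.exp (-(l * t)) * F t) (Ioi 0)) :
    HasLaplace F l (∫ t in Ioi (0 : ℝ), Complex.exp (-(l * t)) * F t) := by
  refine (intervalIntegral_tendsto_integral_Ioi 0 h tendsto_id).congr' ?_
  filter_upwards [eventually_ge_atTop 0] with t ht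
  exact intervalIntegral.integral_of_le ht

lemma norm_lapPartial_le {F : ℝ → ℂ} {l : ℂ}
    (h : IntegrableOn (fun t : ℝ => Complex.exp (-(l * t)) * F t) (Ioi 0)) (t : ℝ) :
    ‖lapPartial F l t‖ ≤ ∫ t in Ioi (0 : ℝ), ‖Complex.exp (-(l * t)) * F t‖ :=
  (norm_integral_le_integral_norm _).trans (setIntegral_mono_set h.norm
    (Eventually.of_forall fun _ => norm_nonneg _) Ioc_subset_Ioi_self.eventuallyLE)

lemma hasMLaplace_prod {n : ℕ} {F : Fin n → ℝ → ℂ} {l L : Fin n → ℂ}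
    (h : ∀ j, HasLaplace (F j) (l j) (L j)) :
    HasMLaplace n (fun s => ∏ j, F j (s j)) l (∏ j, L j) := by
  unfold HasMLaplace
  simp_rw [funext (mLapPartial_prod F l)]
  exact tendsto_finsetProd _ fun j _ => (h j).comp <| tendsto_atTop.2 fun x =>
    (eventually_ge_atTop fun _ => x).mono fun _ ht => ht j

lemma summable_log_div {a b γ : ℝ} (ha : 0 < a) (hb : 0 < b) (hγ : 1 < γ) :
    Summable fun k : ℕ => Real.log (k + 2) / (a + ((k : ℝ) + 1) ^ γ * b) := by
  set e : ℝ := (γ - 1) / 2 with he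
  have he0 : 0 < e := by rw [he]; linarith
  have hsum : Summable fun k : ℕ => (2 ^ e / (e * b)) * (1 / ((k : ℝ) + 1) ^ (γ - e)) := by
    have := (summable_nat_add_iff 1).2
      (Real.summable_one_div_nat_rpow.2 (show 1 < γ - e by rw [he]; linarith))
    simpa using this.mul_left (2 ^ e / (e * b))
  refine hsum.of_nonneg_of_le (fun k => ?_) fun k => ?_
  · exact div_nonneg (Real.log_nonneg (by linarith [(k.cast_nonneg : (0 : ℝ) ≤ k)])) (by positivity)
  · have hk : (0 : ℝ) < (k : ℝ) + 1 := by positivity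
    have h1 : Real.log (k + 2) ≤ (2 * ((k : ℝ) + 1)) ^ e / e :=
      (Real.log_le_log (by positivity) (by linarith)).trans
        (Real.log_le_rpow_div (by positivity) he0)
    have h2 : ((k : ℝ) + 1) ^ γ * b ≤ a + ((k : ℝ) + 1) ^ γ * b := by linarith
    calc Real.log (k + 2) / (a + ((k : ℝ) + 1) ^ γ * b)
        ≤ ((2 * ((k : ℝ) + 1)) ^ e / e) / (((k : ℝ) + 1) ^ γ * b) :=
          div_le_div₀ (by positivity) h1 (by positivity) h2
      _ = _ := by
          rw [Real.mul_rpow zero_le_two hk.le, Real.rpow_sub hk]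
          field_simp

theorem not_isMUniquenessFamily_of_one_lt {n : ℕ} {a b γ : Fin n → ℝ} (ha : ∀ i, 0 < a i)
    (hb : ∀ i, 0 < b i) {i : Fin n} (hi : 1 < γ i) :
    ¬ IsMUniquenessFamily n
      (fun (k : Fin n → ℕ) j => (((a j + ((k j : ℝ) + 1) ^ (γ j) * b j : ℝ)) : ℂ)) := by
  intro H
  have hlam : ∀ (j : Fin n) (m : ℕ), 0 < a j + ((m : ℝ) + 1) ^ (γ j) * b j := fun j m =>
    add_pos (ha j) (mul_pos (by positivity) (hb j))
  obtain ⟨g, hgc, hgb, hg0, t₀, ht₀, hgt₀⟩ :=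
    exists_laplace_eq_zero (hlam i) (summable_log_div (ha i) (hb i) hi)
  set φ : Fin n → ℝ → ℝ := fun j => if j = i then g else fun t => max t 0 with hφ
  have hφi : φ i = g := by simp [hφ]
  have hφj : ∀ j, j ≠ i → φ j = fun t => max t 0 := fun j hj => by simp [hφ, hj]
  have hφc : ∀ j, Continuous (φ j) := fun j => by
    by_cases hj : j = i
    · rw [hj, hφi]; exact hgc
    · rw [hφj j hj]; fun_prop
  have hφb : ∀ j t, |φ j t| ≤ 2 * max t 0 := fun j t => by
    by_cases hj : j = i
    · rw [hj, hφi]; exact hgb t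
    · rw [hφj j hj, abs_of_nonneg (le_max_right _ _)]
      linarith [le_max_right t 0]
  have hInt : ∀ j (l : ℂ), 0 < l.re →
      IntegrableOn (fun t : ℝ => Complex.exp (-(l * t)) * φ j t) (Ioi 0) := fun j l hl =>
    integrableOn_cexp_neg_mul_of_abs_le hl (hφc j) (hφb j)
  set f : (Fin n → ℝ) → ℂ := fun s => ∏ j, (φ j (s j) : ℂ) with hf
  have hfc : Continuous f := by
    refine continuous_finsetProd _ fun j _ => ?_
    exact Complex.continuous_ofReal.comp ((hφc j).comp (continuous_apply j))
  have hae := H f (hfc.locallyIntegrable.locallyIntegrableOn _)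
    ⟨fun _ => 0, fun _ => EReal.zero_ne_top, ?_, fun k j => ?_⟩ fun k => ?_
  · have hx : f (fun j => if j = i then t₀ else 1) ≠ 0 := by
      refine Finset.prod_ne_zero_iff.2 fun j _ => ?_
      rw [Complex.ofReal_ne_zero]
      by_cases hj : j = i
      · rw [hj, hφi]; simpa using hgt₀
      · simp [hφj j hj, hj]
    have hopen : IsOpen ({t : Fin n → ℝ | ∀ j, 0 < t j} ∩ {t | f t ≠ 0}) := by
      refine IsOpen.inter ?_ (isOpen_ne_fun hfc continuous_const)
      simp only [ofPred_forall]
      exact isOpen_iInter_of_finite fun j => isOpen_lt continuous_const (continuous_apply j)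
    refine (hopen.measure_pos volume ⟨_, fun j => ?_, hx⟩).ne' ?_
    · by_cases hj : j = i <;> simp [hj, ht₀]
    · refine measure_mono_null (fun t ht => ?_) hae
      simp only [mem_compl_iff, mem_ofPred_eq, not_forall]
      exact ⟨fun j => (ht.1 j).le, ht.2⟩
  · intro l hl
    have hl' : ∀ j, 0 < (l j).re := fun j => by simpa using hl j
    have hL := hasMLaplace_prod (F := fun j t => (φ j t : ℂ)) (l := l)
      fun j => hasLaplace_of_integrableOn (hInt j (l j) (hl' j))
    refine ⟨?_, _, hL⟩
    refine (isBounded_iff_forall_norm_le (E := ℂ)).2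
      ⟨∏ j, ∫ t in Ioi (0 : ℝ), ‖Complex.exp (-(l j * t)) * φ j t‖, ?_⟩
    rintro _ ⟨t, -, rfl⟩
    rw [hf, mLapPartial_prod (fun j t => (φ j t : ℂ)), norm_prod]
    exact Finset.prod_le_prod (fun _ _ => norm_nonneg _) fun j _ =>
      norm_lapPartial_le (hInt j _ (hl' j)) _
  · change ((0 : ℝ) : EReal) < _
    exact EReal.coe_lt_coe_iff.2 (hlam j (k j))
  · have := hasMLaplace_prod (F := fun j t => (φ j t : ℂ)) fun j =>
      hasLaplace_of_integrableOn (hInt j ((a j + ((k j : ℝ) + 1) ^ (γ j) * b j : ℝ) : ℂ)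
        (by simpa using hlam j (k j)))
    rwa [Finset.prod_eq_zero (Finset.mem_univ i)] at this
    have h0 := congrArg Complex.ofReal (hg0 (k i))
    rw [← integral_complex_ofReal, Complex.ofReal_zero] at h0
    rw [hφi, ← h0]
    congr 1 with t
    push_cast
    rfl

lemma exp_mul_integral_exp {μ q : ℂ} (h : μ ≠ q) (t : ℝ) :
    Complex.exp (-(μ * t)) * ∫ v in (0 : ℝ)..t, Complex.exp (μ * v) * Complex.exp (-(q * v))
      = (Complex.exp (-(q * t)) - Complex.exp (-(μ * t))) / (μ - q) := by
  have h' : μ - q ≠ 0 := sub_ne_zero.2 h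
  have : ∀ v : ℝ, Complex.exp (μ * v) * Complex.exp (-(q * v)) = Complex.exp ((μ - q) * v) :=
    fun v => by rw [← Complex.exp_add]; ring_nf
  simp_rw [this]
  rw [integral_exp_mul_complex h', mul_div_assoc', mul_sub, ← Complex.exp_add, ← Complex.exp_add]
  congr 3
  · ring
  · simp

/-- One step of von Golitschek's iteration decreases the uniform norm by the factor
`‖1 - q / μ‖`. -/
lemma norm_exp_mul_integral_exp_le {μ : ℝ} (hμ : 0 < μ) {Q : ℝ → ℂ} {C : ℝ}
    (hQ : ∀ t, 0 ≤ t → ‖Q t‖ ≤ C) {t : ℝ} (ht : 0 ≤ t) (q : ℂ) :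
    ‖(μ - q) * (Complex.exp (-(μ * t)) * ∫ v in (0 : ℝ)..t, Complex.exp (μ * v) * Q v)‖
      ≤ C * ‖1 - q / μ‖ := by
  have hC : 0 ≤ C := (norm_nonneg _).trans (hQ 0 le_rfl)
  have hle : ‖∫ v in (0 : ℝ)..t, Complex.exp (μ * v) * Q v‖
      ≤ ∫ v in (0 : ℝ)..t, C * Real.exp (μ * v) := by
    refine intervalIntegral.norm_integral_le_of_norm_le ht (Eventually.of_forall fun v hv => ?_)
      (Continuous.intervalIntegrable (by fun_prop) _ _)
    rw [norm_mul, Complex.norm_exp, mul_comm]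
    simpa using mul_le_mul_of_nonneg_right (hQ v hv.1.le) (Real.exp_nonneg (μ * v))
  have hval : ∫ v in (0 : ℝ)..t, C * Real.exp (μ * v) = C * ((Real.exp (μ * t) - 1) / μ) := by
    rw [intervalIntegral.integral_const_mul,
      intervalIntegral.integral_comp_mul_left (fun v => Real.exp v) hμ.ne',
      integral_exp]
    simp [div_eq_inv_mul]
  have hnorm : ‖(μ : ℂ) - q‖ = μ * ‖1 - q / μ‖ := by
    have : (μ : ℂ) - q = μ * (1 - q / μ) := by
      have : (μ : ℂ) ≠ 0 := by exact_mod_cast hμ.ne'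
      field_simp
    rw [this, norm_mul, Complex.norm_real, Real.norm_of_nonneg hμ.le]
  have hexp : ‖Complex.exp (-(μ * t))‖ = Real.exp (-(μ * t)) := by
    rw [Complex.norm_exp]; simp
  rw [hval] at hle
  rw [norm_mul, norm_mul, hnorm, hexp]
  calc μ * ‖1 - q / μ‖ * (Real.exp (-(μ * t)) * ‖∫ v in (0 : ℝ)..t, Complex.exp (μ * v) * Q v‖)
      ≤ μ * ‖1 - q / μ‖ * (Real.exp (-(μ * t)) * (C * ((Real.exp (μ * t) - 1) / μ))) := by gcongr
    _ = C * ‖1 - q / μ‖ * (1 - Real.exp (-(μ * t))) := by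
        have : Real.exp (-(μ * t)) * Real.exp (μ * t) = 1 := by rw [← Real.exp_add]; simp
        field_simp
        linear_combination (C * ‖1 - q / μ‖) * this
    _ ≤ C * ‖1 - q / μ‖ * 1 := by
        gcongr
        linarith [Real.exp_pos (-(μ * t))]
    _ = _ := mul_one _

/-- Quantitative Müntz approximation of `t ↦ exp (-(q * t))` on the half-line. -/
theorem exists_norm_exp_sub_sum_le {μ : ℕ → ℝ} (hμ : ∀ k, 0 < μ k) (hinj : Function.Injective μ)
    {q : ℂ} (hq : 0 ≤ q.re) (n : ℕ) :
    ∃ c : ℕ → ℂ, ∀ t : ℝ, 0 ≤ t →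
      ‖Complex.exp (-(q * t)) - ∑ k ∈ Finset.range n, c k * Complex.exp (-(μ k * t))‖
        ≤ ∏ k ∈ Finset.range n, ‖1 - q / μ k‖ := by
  induction n with
  | zero =>
    refine ⟨0, fun t ht => ?_⟩
    simp only [Finset.range_zero, Finset.sum_empty, sub_zero, Finset.prod_empty, Complex.norm_exp,
      Real.exp_le_one_iff]
    simpa using mul_nonneg hq ht
  | succ n ih =>
    obtain ⟨c, hc⟩ := ih
    by_cases hqn : (μ n : ℂ) = q
    · refine ⟨fun k => if k = n then 1 else 0, fun t _ => ?_⟩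
      rw [Finset.sum_range_succ, Finset.sum_eq_zero, ← hqn]
      · simpa using Finset.prod_nonneg fun k _ => norm_nonneg _
      · intro k hk
        simp [(Finset.mem_range.1 hk).ne]
    · set d : ℕ → ℂ := fun k => c k * ((μ n - q) / (μ n - μ k)) with hd
      refine ⟨fun k => if k = n then 1 - ∑ j ∈ Finset.range n, d j else d k, fun t ht => ?_⟩
      rw [Finset.prod_range_succ]
      convert norm_exp_mul_integral_exp_le (hμ n) hc ht q using 2
      have hqn' : (μ n : ℂ) - q ≠ 0 := sub_ne_zero.2 hqn
      have hne : ∀ k ∈ Finset.range n, (μ n : ℂ) ≠ μ k := fun k hk h =>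
        (Finset.mem_range.1 hk).ne' (hinj (by exact_mod_cast h))
      simp_rw [mul_sub, Finset.mul_sum]
      rw [intervalIntegral.integral_sub (Continuous.intervalIntegrable (by fun_prop) _ _)
        (Continuous.intervalIntegrable (by fun_prop) _ _),
        intervalIntegral.integral_finsetSum
          fun k _ => Continuous.intervalIntegrable (by fun_prop) _ _,
        mul_sub, exp_mul_integral_exp hqn, Finset.mul_sum, mul_sub, mul_div_cancel₀ _ hqn',
        Finset.mul_sum, Finset.sum_range_succ]
      have hterm : ∀ k ∈ Finset.range n,
          ((μ n : ℂ) - q) * (Complex.exp (-(μ n * t)) *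
            ∫ v in (0 : ℝ)..t, Complex.exp (μ n * v) * (c k * Complex.exp (-(μ k * v))))
          = d k * Complex.exp (-(μ k * t)) - d k * Complex.exp (-(μ n * t)) := fun k hk => by
        have : ∀ v : ℝ, Complex.exp (μ n * v) * (c k * Complex.exp (-(μ k * v)))
            = c k * (Complex.exp (μ n * v) * Complex.exp (-(μ k * v))) := fun v => by ring
        simp_rw [this]
        rw [intervalIntegral.integral_const_mul, mul_left_comm (Complex.exp _),
          exp_mul_integral_exp (hne k hk)]
        simp only [hd]
        ring
      rw [Finset.sum_congr rfl hterm, Finset.sum_sub_distrib, ← Finset.sum_mul,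
        Finset.sum_congr rfl (g := fun k => d k * Complex.exp (-(μ k * t)))]
      · simp only [if_true]
        ring
      · intro k hk
        simp [(Finset.mem_range.1 hk).ne]

lemma norm_one_sub_div_le {q : ℂ} {μ : ℝ} (hμ : 0 < μ) (hq : ‖q‖ ^ 2 ≤ μ * q.re) :
    ‖1 - q / μ‖ ≤ Real.exp (-(q.re / 2 * μ⁻¹)) := by
  have hsq : ‖1 - q / μ‖ ^ 2 = 1 - 2 * q.re / μ + ‖q‖ ^ 2 / μ ^ 2 := by
    rw [← Complex.normSq_eq_norm_sq, ← Complex.normSq_eq_norm_sq, Complex.normSq_apply,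
      Complex.normSq_apply]
    simp only [Complex.sub_re, Complex.one_re, Complex.div_ofReal_re, Complex.sub_im,
      Complex.one_im, Complex.div_ofReal_im]
    field_simp
    ring
  have hle : ‖q‖ ^ 2 / μ ^ 2 ≤ q.re / μ := by
    rw [div_le_div_iff₀ (by positivity) hμ]
    nlinarith
  refine le_of_sq_le_sq ?_ (Real.exp_nonneg _)
  rw [hsq, ← Real.exp_nat_mul]
  calc 1 - 2 * q.re / μ + ‖q‖ ^ 2 / μ ^ 2 ≤ -(q.re / μ) + 1 := by
        rw [mul_div_assoc]; linarith
    _ ≤ Real.exp (-(q.re / μ)) := Real.add_one_le_exp _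
    _ = _ := by congr 1; push_cast; field_simp

lemma tendsto_prod_norm_one_sub_div {μ : ℕ → ℝ} (hμ : ∀ k, 0 < μ k)
    (hs : ¬ Summable fun k => (μ k)⁻¹) {q : ℂ} (hq : 0 < q.re)
    (hq' : ∀ k, ‖q‖ ^ 2 ≤ μ k * q.re) :
    Tendsto (fun n => ∏ k ∈ Finset.range n, ‖1 - q / μ k‖) atTop (nhds 0) := by
  have hdiv : Tendsto (fun n => ∑ k ∈ Finset.range n, (μ k)⁻¹) atTop atTop :=
    (not_summable_iff_tendsto_nat_atTop_of_nonneg fun k => (inv_pos.2 (hμ k)).le).1 hs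
  refine squeeze_zero (fun n => Finset.prod_nonneg fun k _ => norm_nonneg _) (fun n => ?_)
    (Real.tendsto_exp_neg_atTop_nhds_zero.comp (hdiv.const_mul_atTop (half_pos hq)))
  refine (Finset.prod_le_prod (fun k _ => norm_nonneg _)
    fun k _ => norm_one_sub_div_le (hμ k) (hq' k)).trans (le_of_eq ?_)
  rw [← Real.exp_sum, Finset.sum_neg_distrib, ← Finset.mul_sum]
  rfl

lemma integrable_cexp_neg_mul {X : Type*} [MeasurableSpace X] {m : Measure X} {W : X → ℂ}
    (hW : Integrable W m) {T : X → ℝ} (hT : Measurable T) (hpos : ∀ x, W x ≠ 0 → 0 ≤ T x)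
    {q : ℂ} (hq : 0 ≤ q.re) :
    Integrable (fun x => Complex.exp (-(q * T x)) * W x) m := by
  refine hW.norm.mono' (Measurable.aestronglyMeasurable (by fun_prop) |>.mul
    hW.aestronglyMeasurable) (Eventually.of_forall fun x => ?_)
  by_cases hx : W x = 0
  · simp [hx]
  · rw [norm_mul, Complex.norm_exp]
    refine mul_le_of_le_one_left (norm_nonneg _) (Real.exp_le_one_iff.2 ?_)
    simpa using mul_nonneg hq (hpos x hx)

/-- Uniqueness principle of Müntz type: integrals against `exp (-(q * T))` vanish as soon as they
vanish for a sequence of real `q` tending to infinity with divergent sum of reciprocals. -/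
theorem integral_cexp_neg_mul_eq_zero {X : Type*} [MeasurableSpace X] {m : Measure X} {W : X → ℂ}
    (hW : Integrable W m) {T : X → ℝ} (hT : Measurable T) (hpos : ∀ x, W x ≠ 0 → 0 ≤ T x)
    {μ : ℕ → ℝ} (hμ : ∀ k, 0 < μ k) (hinj : Function.Injective μ) (htop : Tendsto μ atTop atTop)
    (hs : ¬ Summable fun k => (μ k)⁻¹)
    (hzero : ∀ k, ∫ x, Complex.exp (-(μ k * T x)) * W x ∂m = 0) {q : ℂ} (hq : 0 < q.re) :
    ∫ x, Complex.exp (-(q * T x)) * W x ∂m = 0 := by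
  obtain ⟨K, hK⟩ := eventually_atTop.1
    (htop.eventually_ge_atTop (‖q‖ ^ 2 / q.re))
  set ν : ℕ → ℝ := fun k => μ (k + K) with hν
  have hνpos : ∀ k, 0 < ν k := fun k => hμ _
  have hνs : ¬ Summable fun k => (ν k)⁻¹ := fun h =>
    hs ((summable_nat_add_iff (f := fun k => (μ k)⁻¹) K).1 h)
  have hlim := tendsto_prod_norm_one_sub_div hνpos hνs hq fun k =>
    (div_le_iff₀ hq).1 (hK (k + K) (Nat.le_add_left _ _))
  have hlim' := hlim.mul_const (∫ x, ‖W x‖ ∂m)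
  rw [zero_mul] at hlim'
  refine norm_le_zero_iff.1 (ge_of_tendsto hlim' (Eventually.of_forall fun n => ?_))
  obtain ⟨c, hc⟩ := exists_norm_exp_sub_sum_le hνpos
    (fun i j h => Nat.add_right_cancel (hinj h)) hq.le n
  have hik : ∀ k, Integrable (fun x => Complex.exp (-(ν k * T x)) * W x) m := fun k =>
    integrable_cexp_neg_mul hW hT hpos (by simpa using (hνpos k).le)
  have hdiff : ∫ x, Complex.exp (-(q * T x)) * W x ∂m
      = ∫ x, (Complex.exp (-(q * T x))
          - ∑ k ∈ Finset.range n, c k * Complex.exp (-(ν k * T x))) * W x ∂m := by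
    simp_rw [sub_mul, Finset.sum_mul, mul_assoc]
    rw [integral_sub (integrable_cexp_neg_mul hW hT hpos hq.le)
        (integrable_finsetSum _ fun k _ => (hik k).const_mul _),
      integral_finsetSum _ fun k _ => (hik k).const_mul _, Finset.sum_eq_zero, sub_zero]
    intro k _
    rw [integral_const_mul, hzero, mul_zero]
  rw [hdiff, ← integral_const_mul]
  refine norm_integral_le_of_norm_le (hW.norm.const_mul _) (Eventually.of_forall fun x => ?_)
  by_cases hx : W x = 0
  · simp [hx]
  · rw [norm_mul]
    exact mul_le_mul_of_nonneg_right (hc _ (hpos x hx)) (norm_nonneg _)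

lemma integrable_cexp_neg_sum_mul {n : ℕ} {W : (Fin n → ℝ) → ℂ} (hW : Integrable W)
    (hpos : ∀ t, W t ≠ 0 → ∀ j, 0 ≤ t j) (S : Finset (Fin n)) {q : Fin n → ℂ}
    (hq : ∀ j, 0 ≤ (q j).re) :
    Integrable (fun t => Complex.exp (-∑ j ∈ S, q j * t j) * W t) := by
  refine hW.norm.mono' ((Continuous.aestronglyMeasurable (by fun_prop)).mul
    hW.aestronglyMeasurable) (Eventually.of_forall fun t => ?_)
  by_cases ht : W t = 0
  · simp [ht]
  · rw [norm_mul, Complex.norm_exp]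
    refine mul_le_of_le_one_left (norm_nonneg _) (Real.exp_le_one_iff.2 ?_)
    simpa using Finset.sum_nonneg fun j _ => mul_nonneg (hq j) (hpos t ht j)

/-- Multidimensional version of `integral_cexp_neg_mul_eq_zero`, one coordinate at a time. -/
theorem integral_cexp_neg_sum_mul_eq_zero {n : ℕ} {W : (Fin n → ℝ) → ℂ} (hW : Integrable W)
    (hpos : ∀ t, W t ≠ 0 → ∀ j, 0 ≤ t j) {μ : Fin n → ℕ → ℝ} (hμ : ∀ j k, 0 < μ j k)
    (hinj : ∀ j, Function.Injective (μ j)) (htop : ∀ j, Tendsto (μ j) atTop atTop)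
    (hs : ∀ j, ¬ Summable fun k => (μ j k)⁻¹)
    (hzero : ∀ k : Fin n → ℕ, ∫ t, Complex.exp (-∑ j, (μ j (k j) : ℂ) * t j) * W t = 0)
    {q : Fin n → ℂ} (hq : ∀ j, 0 < (q j).re) :
    ∫ t, Complex.exp (-∑ j, q j * t j) * W t = 0 := by
  suffices H : ∀ (S : Finset (Fin n)) (q : Fin n → ℂ), (∀ j, 0 < (q j).re) →
      (∀ j ∉ S, ∃ k : ℕ, q j = μ j k) → ∫ t, Complex.exp (-∑ j, q j * t j) * W t = 0 from
    H Finset.univ q hq fun j hj => absurd (Finset.mem_univ j) hj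
  intro S
  induction S using Finset.induction_on with
  | empty =>
    intro q _ hk
    choose k hk using fun j => hk j (Finset.notMem_empty j)
    simpa only [hk] using hzero k
  | insert i S hiS ih =>
    intro q hq hk
    set V : (Fin n → ℝ) → ℂ :=
      fun t => Complex.exp (-∑ j ∈ Finset.univ.erase i, q j * t j) * W t with hV
    have hsplit : ∀ (p : Fin n → ℂ), (∀ j ≠ i, p j = q j) → ∀ t,
        Complex.exp (-∑ j, p j * t j) * W t = Complex.exp (-(p i * t i)) * V t := fun p hp t => by
      rw [hV, ← mul_assoc, ← Complex.exp_add, ← neg_add,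
        ← Finset.add_sum_erase _ _ (Finset.mem_univ i)]
      congr 4
      exact Finset.sum_congr rfl fun j hj => by rw [hp j (Finset.ne_of_mem_erase hj)]
    simp_rw [hsplit q fun _ _ => rfl]
    refine integral_cexp_neg_mul_eq_zero
      (integrable_cexp_neg_sum_mul hW hpos _ fun j => (hq j).le) (measurable_pi_apply i)
      (fun t ht => hpos t (right_ne_zero_of_mul ht) i) (hμ i) (hinj i) (htop i) (hs i)
      (fun m => ?_) (hq i)
    have := ih (Function.update q i (μ i m)) (fun j => ?_) fun j hj => ?_
    · simp_rw [hsplit (Function.update q i (μ i m))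
        fun j hj => Function.update_of_ne hj _ _] at this
      simpa only [Function.update_self] using this
    · by_cases hj : j = i
      · subst hj; simpa using hμ j m
      · simpa [hj] using hq j
    · by_cases hji : j = i
      · subst hji; exact ⟨m, by simp⟩
      · simpa [hji] using hk j (by simp [hji, hj])

/-- An integrable function with vanishing Fourier transform vanishes at its continuity points. -/
theorem eq_zero_of_integral_cexp_eq_zero {n : ℕ} {W : (Fin n → ℝ) → ℂ} (hW : Integrable W)
    (h : ∀ ξ : Fin n → ℝ,
      ∫ t, Complex.exp (-∑ j, (2 * Real.pi * ξ j * Complex.I : ℂ) * t j) * W t = 0)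
    {x : Fin n → ℝ} (hx : ContinuousAt W x) : W x = 0 := by
  set V : EuclideanSpace ℝ (Fin n) → ℂ := fun v => W v.ofLp with hV
  have hVi : Integrable V := (PiLp.volume_preserving_ofLp (Fin n)).integrable_comp_of_integrable hW
  have hF : FourierTransform.fourier V = 0 := by
    ext w
    rw [Real.fourier_eq', ← (PiLp.volume_preserving_toLp (Fin n)).integral_comp
      (MeasurableEquiv.toLp 2 (Fin n → ℝ)).measurableEmbedding]
    refine Eq.trans ?_ (h w.ofLp)
    congr 1 with t
    rw [smul_eq_mul]
    congr 2
    simp only [PiLp.inner_apply, RCLike.inner_apply, conj_trivial]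
    push_cast
    rw [Finset.mul_sum, Finset.sum_mul, ← Finset.sum_neg_distrib]
    exact Finset.sum_congr rfl fun j _ => by ring
  have hc : ContinuousAt V (WithLp.toLp 2 x) :=
    ContinuousAt.comp (f := fun v : EuclideanSpace ℝ (Fin n) => v.ofLp) (g := W) hx
      (PiLp.continuous_ofLp 2 _).continuousAt
  have := hVi.fourierInv_fourier_eq (by rw [hF]; exact integrable_zero _ _ _) hc
  rw [hF, Real.fourierInv_eq'] at this
  simpa [hV] using this.symm

/-- The half-open box `∏ᵢ (0, tᵢ]`. -/
def boxIoc {n : ℕ} (t : Fin n → ℝ) : Set (Fin n → ℝ) := Set.pi univ fun i => Ioc 0 (t i)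

/-- The open orthant `(0, ∞)ⁿ`. -/
def posOrthant (n : ℕ) : Set (Fin n → ℝ) := Set.pi univ fun _ => Ioi 0

lemma measurableSet_boxIoc {n : ℕ} (t : Fin n → ℝ) : MeasurableSet (boxIoc t) :=
  MeasurableSet.univ_pi fun _ => measurableSet_Ioc

lemma isOpen_posOrthant (n : ℕ) : IsOpen (posOrthant n) :=
  isOpen_set_pi finite_univ fun _ _ => isOpen_Ioi

lemma boxIoc_mono {n : ℕ} {s t : Fin n → ℝ} (h : s ≤ t) : boxIoc s ⊆ boxIoc t :=
  pi_mono fun i _ => Ioc_subset_Ioc_right (h i)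

lemma boxIoc_inf {n : ℕ} (s t : Fin n → ℝ) : boxIoc (s ⊓ t) = Iic s ∩ boxIoc t := by
  ext x
  simp only [boxIoc, Set.mem_pi, mem_univ, true_imp_iff, mem_Ioc, Pi.inf_apply,
    le_inf_iff, mem_inter_iff,
    mem_Iic, Pi.le_def]
  exact ⟨fun h => ⟨fun i => (h i).2.1, fun i => ⟨(h i).1, (h i).2.2⟩⟩,
    fun h i => ⟨(h.2 i).1, h.1 i, (h.2 i).2⟩⟩

lemma continuous_setIntegral_boxIoc {n : ℕ} {h : (Fin n → ℝ) → ℂ}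
    (hInt : ∀ t, IntegrableOn h (boxIoc t)) : Continuous fun t => ∫ s in boxIoc t, h s := by
  refine continuous_iff_continuousAt.2 fun x => ?_
  simp_rw [← integral_indicator (measurableSet_boxIoc _)]
  refine continuousAt_of_dominated (bound := (boxIoc (x + 1)).indicator fun s => ‖h s‖)
    (Eventually.of_forall fun t => ((hInt t).integrable_indicator
      (measurableSet_boxIoc t)).aestronglyMeasurable) ?_
    (IntegrableOn.integrable_indicator (hInt (x + 1)).norm (measurableSet_boxIoc _)) ?_
  · have : ∀ᶠ t in nhds x, ∀ i, t i < x i + 1 := by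
      refine eventually_all.2 fun i => ?_
      exact (continuous_apply i).continuousAt.eventually_lt_const (by linarith)
    filter_upwards [this] with t ht
    refine Eventually.of_forall fun s => ?_
    rw [norm_indicator_eq_indicator_norm]
    exact indicator_le_indicator_of_subset (boxIoc_mono fun i => (ht i).le)
      (fun _ => norm_nonneg _) s
  · have hne : ∀ᵐ s : Fin n → ℝ, ∀ i, s i ≠ x i :=
      ae_all_iff.2 fun i => Measure.ae_eval_ne (μ := fun _ : Fin n => (volume : Measure ℝ)) i (x i)
    filter_upwards [hne] with s hs
    have : ∀ᶠ t in nhds x, ∀ i, (s i ≤ t i ↔ s i ≤ x i) := by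
      refine eventually_all.2 fun i => ?_
      rcases lt_or_gt_of_ne (hs i) with hlt | hgt
      · filter_upwards [(continuous_apply i).continuousAt.eventually_const_lt hlt] with t ht
        exact iff_of_true ht.le hlt.le
      · filter_upwards [(continuous_apply i).continuousAt.eventually_lt_const hgt] with t ht
        exact iff_of_false ht.not_ge hgt.not_ge
    refine ContinuousAt.congr (f := fun _ => (boxIoc x).indicator h s) continuousAt_const
      (this.mono fun t ht => ?_)
    show (boxIoc x).indicator h s = (boxIoc t).indicator h s
    have hmem : s ∈ boxIoc x ↔ s ∈ boxIoc t := by simp [boxIoc, ht]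
    by_cases hsx : s ∈ boxIoc x
    · rw [indicator_of_mem hsx, indicator_of_mem (hmem.1 hsx)]
    · rw [indicator_of_notMem hsx, indicator_of_notMem (mt hmem.2 hsx)]

/-- Functions whose integrals over all boxes anchored at the origin vanish are zero. -/
theorem ae_eq_zero_of_forall_setIntegral_boxIoc_eq_zero {n : ℕ} {h : (Fin n → ℝ) → ℂ}
    (hInt : ∀ t, IntegrableOn h (boxIoc t)) (hzero : ∀ t, ∫ s in boxIoc t, h s = 0) :
    ∀ᵐ s, s ∈ posOrthant n → h s = 0 := by
  have hbox : ∀ T : Fin n → ℝ, ∀ᵐ s, s ∈ boxIoc T → h s = 0 := fun T => by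
    rw [← ae_restrict_iff' (measurableSet_boxIoc T)]
    refine (hInt T).ae_eq_zero_of_forall_setIntegral_eq_zero fun A hA hAfin => ?_
    clear hAfin
    have hgen : (MeasurableSpace.pi : MeasurableSpace (Fin n → ℝ))
        = .generateFrom (pi univ '' pi univ fun _ : Fin n => range (Iic : ℝ → Set ℝ)) := by
      refine (generateFrom_eq_pi (fun _ => ?_) fun _ => ?_).symm
      · rw [← borel_eq_generateFrom_Iic ℝ, BorelSpace.measurable_eq (α := ℝ)]
      · refine ⟨fun m : ℕ => Iic (m : ℝ), fun m => ⟨_, rfl⟩, ?_⟩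
        exact iUnion_eq_univ_iff.2 fun x => exists_nat_ge x
    induction A, hA using MeasurableSpace.induction_on_inter hgen
      (IsPiSystem.pi fun _ => isPiSystem_Iic) with
    | empty => simp
    | basic A hA =>
      obtain ⟨C, hC, rfl⟩ := hA
      choose t ht using fun i => hC i (mem_univ i)
      have hCt : pi univ C = Iic t := by
        rw [← pi_univ_Iic]
        congr with i : 1
        exact (ht i).symm
      rw [hCt, Measure.restrict_restrict measurableSet_Iic, ← boxIoc_inf]
      exact hzero _
    | compl A hA ihA =>
      have := integral_add_compl hA (hInt T)
      rw [ihA, zero_add, hzero] at this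
      exact this
    | iUnion A hdisj hA ihA =>
      rw [integral_iUnion hA hdisj (hInt T).integrableOn]
      simp [ihA]
  have hall : ∀ᵐ s, ∀ m : ℕ, s ∈ boxIoc (fun _ : Fin n => (m : ℝ)) → h s = 0 :=
    ae_all_iff.2 fun m => hbox _
  filter_upwards [hall] with s hs hpos
  obtain ⟨m, hm⟩ := exists_nat_ge (∑ i, |s i|)
  refine hs m fun i _ => ⟨hpos i (mem_univ i), ?_⟩
  exact (le_abs_self _).trans ((Finset.single_le_sum (fun i _ => abs_nonneg (s i))
    (Finset.mem_univ i)).trans hm)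

lemma integrableOn_prod_exp {n : ℕ} {μ : Fin n → ℝ} (hμ : ∀ j, 0 < μ j) :
    IntegrableOn (fun u : Fin n → ℝ => ∏ j, ((μ j * Real.exp (-(μ j * u j)) : ℝ) : ℂ))
      (posOrthant n) := by
  rw [IntegrableOn, posOrthant, volume_pi, Measure.restrict_pi_pi]
  refine Integrable.fintype_prod (f := fun j x => ((μ j * Real.exp (-(μ j * x)) : ℝ) : ℂ))
    fun j => Integrable.ofReal (𝕜 := ℂ) ?_
  have := (integrableOn_exp_mul_Ioi (neg_lt_zero.2 (hμ j)) 0).const_mul (μ j)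
  simp only [neg_mul] at this
  exact this

lemma setIntegral_Ici_prod_exp {n : ℕ} {μ : Fin n → ℝ} (hμ : ∀ j, 0 < μ j) (s : Fin n → ℝ) :
    ∫ u in Ici s, ∏ j, ((μ j * Real.exp (-(μ j * u j)) : ℝ) : ℂ)
      = Complex.exp (-∑ j, (μ j : ℂ) * s j) := by
  rw [← pi_univ_Ici, volume_pi, Measure.restrict_pi_pi,
    integral_fintype_prod_eq_prod (fun j x => ((μ j * Real.exp (-(μ j * x)) : ℝ) : ℂ)),
    ← Finset.sum_neg_distrib, Complex.exp_sum]
  refine Finset.prod_congr rfl fun j _ => ?_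
  have hval : ∫ x in Ici (s j), μ j * Real.exp (-(μ j * x)) = Real.exp (-(μ j * s j)) := by
    rw [integral_Ici_eq_integral_Ioi, integral_const_mul]
    simp_rw [← neg_mul]
    rw [integral_exp_mul_Ioi (neg_lt_zero.2 (hμ j))]
    have := (hμ j).ne'
    field_simp
  rw [integral_complex_ofReal, hval]
  push_cast
  rfl

/-- Integration by parts for the partial Laplace integral over a box, in the form of averaging the
primitive against exponential densities. -/
theorem setIntegral_boxIoc_cexp_mul {n : ℕ} {h : (Fin n → ℝ) → ℂ}
    (hInt : ∀ t, IntegrableOn h (boxIoc t)) {μ : Fin n → ℝ} (hμ : ∀ j, 0 < μ j)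
    (T : Fin n → ℝ) :
    ∫ s in boxIoc T, Complex.exp (-∑ j, (μ j : ℂ) * s j) * h s
      = ∫ u in posOrthant n, (∏ j, ((μ j * Real.exp (-(μ j * u j)) : ℝ) : ℂ))
          * ∫ s in boxIoc (u ⊓ T), h s := by
  set D : (Fin n → ℝ) → ℂ := fun u => ∏ j, ((μ j * Real.exp (-(μ j * u j)) : ℝ) : ℂ) with hD
  set E : Set ((Fin n → ℝ) × (Fin n → ℝ)) := {p | p.1 ≤ p.2} with hE
  have hEm : MeasurableSet E := measurableSet_le measurable_fst measurable_snd
  have hprod : Integrable (E.indicator fun p => h p.1 * D p.2)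
      ((volume.restrict (boxIoc T)).prod (volume.restrict (posOrthant n))) :=
    (Integrable.mul_prod (hInt T) (integrableOn_prod_exp hμ)).indicator hEm
  have hinner : ∀ s ∈ boxIoc T, Complex.exp (-∑ j, (μ j : ℂ) * s j) * h s
      = ∫ u in posOrthant n, E.indicator (fun p => h p.1 * D p.2) (s, u) := fun s hs => by
    have h1 : ∀ u, E.indicator (fun p => h p.1 * D p.2) (s, u)
        = (Ici s).indicator (fun u => h s * D u) u := fun u => rfl
    have h2 : posOrthant n ∩ Ici s = Ici s :=
      inter_eq_right.2 fun u hu i _ => (hs i (mem_univ i)).1.trans_le (hu i)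
    simp_rw [h1]
    rw [setIntegral_indicator measurableSet_Ici, h2, integral_const_mul,
      setIntegral_Ici_prod_exp hμ, mul_comm]
  rw [setIntegral_congr_fun (measurableSet_boxIoc T) hinner,
    integral_integral_swap (f := fun s u => E.indicator (fun p => h p.1 * D p.2) (s, u)) hprod]
  congr 1 with u
  have h1 : ∀ s, E.indicator (fun p => h p.1 * D p.2) (s, u)
      = (Iic u).indicator (fun s => h s * D u) s := fun s => rfl
  simp_rw [h1]
  rw [setIntegral_indicator measurableSet_Iic, integral_mul_const, inter_comm, ← boxIoc_inf,
    mul_comm]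

theorem setIntegral_posOrthant_cexp_mul_eq_zero {n : ℕ} {h : (Fin n → ℝ) → ℂ}
    (hInt : ∀ t, IntegrableOn h (boxIoc t)) {M : ℝ} (hM : ∀ t, ‖∫ s in boxIoc t, h s‖ ≤ M)
    {μ : Fin n → ℝ} (hμ : ∀ j, 0 < μ j)
    (hlim : Tendsto (fun T => ∫ s in boxIoc T, Complex.exp (-∑ j, (μ j : ℂ) * s j) * h s) atTop
      (nhds 0)) :
    ∫ u in posOrthant n, Complex.exp (-∑ j, (μ j : ℂ) * u j) * ∫ s in boxIoc u, h s = 0 := by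
  set D : (Fin n → ℝ) → ℂ := fun u => ∏ j, ((μ j * Real.exp (-(μ j * u j)) : ℝ) : ℂ) with hD
  have hcont := continuous_setIntegral_boxIoc hInt
  have hDc : Continuous D := by fun_prop
  have hseq : Tendsto (fun m : ℕ => fun _ : Fin n => (m : ℝ)) atTop atTop :=
    tendsto_atTop.2 fun t => by
      have : ∀ᶠ m : ℕ in atTop, ∀ i, t i ≤ m := eventually_all.2 fun i =>
        tendsto_natCast_atTop_atTop.eventually_ge_atTop (t i)
      exact this
  have hdom : Tendsto (fun m : ℕ => ∫ u in posOrthant n,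
      D u * ∫ s in boxIoc (u ⊓ fun _ => (m : ℝ)), h s) atTop
      (nhds (∫ u in posOrthant n, D u * ∫ s in boxIoc u, h s)) := by
    refine tendsto_integral_of_dominated_convergence (fun u => ‖D u‖ * M) (fun m => ?_)
      ((integrableOn_prod_exp hμ).norm.mul_const M) (fun m => Eventually.of_forall fun u => ?_)
      (Eventually.of_forall fun u => ?_)
    · exact (hDc.mul (hcont.comp (continuous_pi fun i =>
        (continuous_apply i).min continuous_const))).aestronglyMeasurable
    · rw [norm_mul]
      exact mul_le_mul_of_nonneg_left (hM _) (norm_nonneg _)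
    · refine tendsto_const_nhds.congr' ?_
      filter_upwards [hseq.eventually_ge_atTop u] with m hm
      rw [inf_eq_left.2 hm]
  have hzero : ∫ u in posOrthant n, D u * ∫ s in boxIoc u, h s = 0 := by
    refine tendsto_nhds_unique hdom ((hlim.comp hseq).congr fun m => ?_)
    exact setIntegral_boxIoc_cexp_mul hInt hμ _
  have hDe : ∀ u, D u = (∏ j, (μ j : ℂ)) * Complex.exp (-∑ j, (μ j : ℂ) * u j) := fun u => by
    rw [hD, ← Finset.sum_neg_distrib, Complex.exp_sum, ← Finset.prod_mul_distrib]
    push_cast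
    rfl
  simp_rw [hDe, mul_assoc] at hzero
  rw [integral_const_mul] at hzero
  refine (mul_eq_zero.1 hzero).resolve_left (Finset.prod_ne_zero_iff.2 fun j _ => ?_)
  exact_mod_cast (hμ j).ne'

/-- A function with bounded primitive whose Laplace transform vanishes on a product of Müntz
sequences is zero on the orthant. -/
theorem ae_eq_zero_of_setIntegral_cexp_mul_eq_zero {n : ℕ} {h : (Fin n → ℝ) → ℂ}
    (hInt : ∀ t, IntegrableOn h (boxIoc t)) {M : ℝ} (hM : ∀ t, ‖∫ s in boxIoc t, h s‖ ≤ M)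
    {δ : Fin n → ℝ} (hδ : ∀ j, 0 < δ j)
    {μ : Fin n → ℕ → ℝ} (hμ : ∀ j k, 0 < μ j k)
    (hinj : ∀ j, Function.Injective (μ j)) (htop : ∀ j, Tendsto (μ j) atTop atTop)
    (hs : ∀ j, ¬ Summable fun k => (μ j k)⁻¹)
    (hzero : ∀ k : Fin n → ℕ, ∫ u in posOrthant n,
      Complex.exp (-∑ j, ((δ j + μ j (k j) : ℝ) : ℂ) * u j) * ∫ s in boxIoc u, h s = 0) :
    ∀ᵐ s, s ∈ posOrthant n → h s = 0 := by
  have hOm : MeasurableSet (posOrthant n) := (isOpen_posOrthant n).measurableSet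
  have hcont := continuous_setIntegral_boxIoc hInt
  set G : (Fin n → ℝ) → ℂ := fun u => ∫ s in boxIoc u, h s with hG
  set W : (Fin n → ℝ) → ℂ :=
    (posOrthant n).indicator fun u => Complex.exp (-∑ j, (δ j : ℂ) * u j) * G u with hWdef
  have hW : Integrable W := by
    refine IntegrableOn.integrable_indicator ?_ hOm
    have hexp : IntegrableOn (fun u : Fin n → ℝ => Complex.exp (-∑ j, (δ j : ℂ) * u j))
        (posOrthant n) := by
      have hne : (∏ j, (δ j : ℂ)) ≠ 0 :=
        Finset.prod_ne_zero_iff.2 fun j _ => by exact_mod_cast (hδ j).ne'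
      refine ((integrableOn_prod_exp hδ).const_mul (∏ j, (δ j : ℂ))⁻¹).congr
        (Eventually.of_forall fun u => ?_)
      simp only [Complex.ofReal_mul, Finset.prod_mul_distrib]
      rw [inv_mul_cancel_left₀ hne, ← Finset.sum_neg_distrib, Complex.exp_sum]
      push_cast
      rfl
    exact hexp.mul_bdd hcont.aestronglyMeasurable (Eventually.of_forall hM)
  have hpos : ∀ t, W t ≠ 0 → ∀ j, 0 ≤ t j := fun t ht j =>
    le_of_lt (mem_of_indicator_ne_zero ht j (mem_univ j))
  have hmul : ∀ (p : Fin n → ℂ) (t : Fin n → ℝ), Complex.exp (-∑ j, p j * t j) * W t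
      = (posOrthant n).indicator
          (fun u => Complex.exp (-∑ j, (δ j + p j) * u j) * G u) t := fun p t => by
    by_cases ht : t ∈ posOrthant n
    · rw [hWdef, indicator_of_mem ht, indicator_of_mem ht, ← mul_assoc, ← Complex.exp_add]
      simp only [add_mul, Finset.sum_add_distrib]
      congr 2
      ring
    · rw [hWdef, indicator_of_notMem ht, indicator_of_notMem ht, mul_zero]
  have hvan : ∀ q : Fin n → ℂ, (∀ j, 0 < (q j).re) →
      ∫ t, Complex.exp (-∑ j, q j * t j) * W t = 0 := fun q hq => by
    refine integral_cexp_neg_sum_mul_eq_zero hW hpos hμ hinj htop hs (fun k => ?_) hq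
    simp_rw [hmul]
    rw [integral_indicator hOm, ← hzero k]
    simp only [Complex.ofReal_add, hG]
  have hGzero : ∀ x ∈ posOrthant n, G x = 0 := fun x hx => by
    have hV := integrable_cexp_neg_sum_mul hW hpos Finset.univ (q := fun _ => 1) (by simp)
    have hc : ContinuousAt (fun t : Fin n → ℝ =>
        Complex.exp (-∑ j, (1 : ℂ) * t j) * W t) x := by
      refine ContinuousAt.mul (Continuous.continuousAt (by fun_prop)) ?_
      refine ContinuousAt.congr (f := fun u => Complex.exp (-∑ j, (δ j : ℂ) * u j) * G u)
        (Continuous.continuousAt (by fun_prop)) ?_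
      filter_upwards [(isOpen_posOrthant n).mem_nhds hx] with u hu
      rw [hWdef, indicator_of_mem hu]
    have := eq_zero_of_integral_cexp_eq_zero hV (fun ξ => ?_) hc
    · simpa [hWdef, indicator_of_mem hx, Complex.exp_ne_zero] using this
    · rw [← hvan (fun j => 2 * Real.pi * ξ j * Complex.I + 1) fun j => by simp]
      congr 1 with t
      rw [← mul_assoc, ← Complex.exp_add]
      simp only [add_mul, Finset.sum_add_distrib]
      congr 2
      ring
  refine ae_eq_zero_of_forall_setIntegral_boxIoc_eq_zero hInt fun t => ?_
  by_cases ht : t ∈ posOrthant n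
  · exact hGzero t ht
  · have : boxIoc t = ∅ := by
      refine eq_empty_of_forall_notMem fun s hs => ht fun i _ => ?_
      exact (hs i (mem_univ i)).1.trans_le (hs i (mem_univ i)).2
    simp [this]

section Progression

variable {b γ : ℝ} (c : ℝ)

lemma strictMono_add_rpow_mul (hb : 0 < b) (hγ : 0 < γ) :
    StrictMono fun k : ℕ => c + ((k : ℝ) + 1) ^ γ * b := fun k m hkm => by
  have : (k : ℝ) + 1 < m + 1 := by exact_mod_cast Nat.succ_lt_succ hkm
  have := mul_lt_mul_of_pos_right (Real.rpow_lt_rpow (by positivity) this hγ) hb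
  simpa using this

lemma tendsto_add_rpow_mul (hb : 0 < b) (hγ : 0 < γ) :
    Tendsto (fun k : ℕ => c + ((k : ℝ) + 1) ^ γ * b) atTop atTop := by
  refine tendsto_atTop_add_const_left _ _ (Tendsto.atTop_mul_const hb ?_)
  exact (tendsto_rpow_atTop hγ).comp
    (tendsto_atTop_add_const_right _ _ tendsto_natCast_atTop_atTop)

lemma not_summable_inv_add_rpow_mul (hb : 0 < b) (hγ : γ ≤ 1)
    (hpos : ∀ k : ℕ, 0 < c + ((k : ℝ) + 1) ^ γ * b) :
    ¬ Summable fun k : ℕ => (c + ((k : ℝ) + 1) ^ γ * b)⁻¹ := fun hs => by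
  have hC : 0 < |c| + b := by positivity
  have hle : ∀ k : ℕ, ((k : ℝ) + 1)⁻¹ ≤ (|c| + b) * (c + ((k : ℝ) + 1) ^ γ * b)⁻¹ := fun k => by
    have h1 : ((k : ℝ) + 1) ^ γ ≤ (k : ℝ) + 1 :=
      Real.rpow_le_self_of_one_le (by linarith [(k.cast_nonneg : (0 : ℝ) ≤ k)]) hγ
    have h2 := mul_le_mul_of_nonneg_right h1 hb.le
    have h3 : c ≤ |c| * ((k : ℝ) + 1) :=
      (le_abs_self c).trans (le_mul_of_one_le_right (abs_nonneg c)
        (by linarith [(k.cast_nonneg : (0 : ℝ) ≤ k)]))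
    rw [← div_eq_mul_inv, le_div_iff₀ (hpos k), inv_mul_le_iff₀ (by positivity)]
    linarith
  refine Real.not_summable_natCast_inv ((summable_nat_add_iff 1).1 ?_)
  refine ((hs.mul_left (|c| + b)).of_nonneg_of_le (fun k => by positivity) hle).congr fun k => ?_
  push_cast
  rfl

end Progression

theorem isMUniquenessFamily_of_le_one {n : ℕ} {a b γ : Fin n → ℝ}
    (hb : ∀ i, 0 < b i) (hγ : ∀ i, 0 < γ i) (hγ1 : ∀ i, γ i ≤ 1) :
    IsMUniquenessFamily n
      (fun (k : Fin n → ℕ) j => (((a j + ((k j : ℝ) + 1) ^ (γ j) * b j : ℝ)) : ℂ)) := by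
  rintro f hf ⟨ω, -, hsub, hlt⟩ hz
  have hlt0 : ∀ j, ω j < ((a j + b j : ℝ) : EReal) := fun j => by
    simpa only [Nat.cast_zero, zero_add, Real.one_rpow, one_mul, Complex.ofReal_re] using
      hlt (fun _ => 0) j
  choose x hωx hxab using fun j => EReal.lt_iff_exists_real_btwn.1 (hlt0 j)
  have hxab' : ∀ j, x j < a j + b j := fun j => EReal.coe_lt_coe_iff.1 (hxab j)
  set h : (Fin n → ℝ) → ℂ := fun s => Complex.exp (-∑ j, (x j : ℂ) * s j) * f s with hh
  have hInt : ∀ t, IntegrableOn h (boxIoc t) := fun t => by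
    have hcpt : IntegrableOn f (Icc 0 t) :=
      hf.integrableOn_compact_subset (fun s hs i => hs.1 i) isCompact_Icc
    have : IntegrableOn h (Icc 0 t) :=
      hcpt.continuousOn_mul (Continuous.continuousOn (by fun_prop)) isCompact_Icc
    exact this.mono_set fun s hs =>
      ⟨fun i => (hs i (mem_univ i)).1.le, fun i => (hs i (mem_univ i)).2⟩
  obtain ⟨M, hM⟩ : ∃ M, ∀ t, ‖∫ s in boxIoc t, h s‖ ≤ M := by
    have hmem : (fun j => (x j : ℂ)) ∈ mOmegaB n f :=
      (hsub fun j => by simpa using hωx j).1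
    obtain ⟨M, hM⟩ := (isBounded_iff_forall_norm_le (E := ℂ)).1 hmem
    refine ⟨max M 0, fun t => ?_⟩
    by_cases ht : ∀ i, 0 ≤ t i
    · exact (hM _ ⟨t, ht, rfl⟩).trans (le_max_left _ _)
    · have : boxIoc t = ∅ := by
        refine eq_empty_of_forall_notMem fun s hs => ht fun i => ?_
        exact (hs i (mem_univ i)).1.le.trans (hs i (mem_univ i)).2
      simp [this]
  set δ : Fin n → ℝ := fun j => (a j + b j - x j) / 2 with hδdef
  have hδ : ∀ j, 0 < δ j := fun j => half_pos (by linarith [hxab' j])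
  have hpos : ∀ j (k : ℕ), 0 < (a j - x j - δ j) + ((k : ℝ) + 1) ^ (γ j) * b j := fun j k => by
    have h1 : 1 ≤ ((k : ℝ) + 1) ^ (γ j) :=
      Real.one_le_rpow (by linarith [(k.cast_nonneg : (0 : ℝ) ≤ k)]) (hγ j).le
    have h2 := mul_le_mul_of_nonneg_right h1 (hb j).le
    have h3 : 2 * δ j = a j + b j - x j := by simp only [hδdef]; ring
    linarith [hδ j]
  have hae := ae_eq_zero_of_setIntegral_cexp_mul_eq_zero hInt hM hδ hpos
    (fun j => (strictMono_add_rpow_mul _ (hb j) (hγ j)).injective)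
    (fun j => tendsto_add_rpow_mul _ (hb j) (hγ j))
    (fun j => not_summable_inv_add_rpow_mul _ (hb j) (hγ1 j) (hpos j)) fun k => ?_
  · have hne : ∀ᵐ s : Fin n → ℝ, ∀ i, s i ≠ 0 :=
      ae_all_iff.2 fun i => Measure.ae_eval_ne (μ := fun _ : Fin n => (volume : Measure ℝ)) i 0
    filter_upwards [hae, hne] with s hs hs0 hnonneg
    exact (mul_eq_zero.1 (hs fun i _ => lt_of_le_of_ne (hnonneg i) (hs0 i).symm)).resolve_left
      (Complex.exp_ne_zero _)
  · refine setIntegral_posOrthant_cexp_mul_eq_zero hInt hM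
      (fun j => add_pos (hδ j) (hpos j (k j))) ?_
    refine (hz k).congr fun T => ?_
    refine setIntegral_congr_fun (measurableSet_boxIoc T) fun s _ => ?_
    simp only [hh]
    rw [← mul_assoc, ← Complex.exp_add, ← neg_add, ← Finset.sum_add_distrib]
    congr 3
    refine Finset.sum_congr rfl fun j _ => ?_
    push_cast
    ring

theorem stmt10 (n : ℕ) (a b γ : Fin n → ℝ) (ha : ∀ i, 0 < a i) (hb : ∀ i, 0 < b i)
    (hγ : ∀ i, 0 < γ i) :
    IsMUniquenessFamily n
      (fun (k : Fin n → ℕ) j => (((a j + ((k j : ℝ) + 1) ^ (γ j) * b j : ℝ)) : ℂ)) ↔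
      ∀ i, γ i ≤ 1 := by
  refine ⟨fun H i => ?_, isMUniquenessFamily_of_le_one hb hγ⟩
  by_contra! hi
  exact not_isMUniquenessFamily_of_one_lt ha hb hi H

end
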